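/- Let p ≥ 1 and let P be a finite nonempty set of n points in ℝ^d. Let t ∈ ℝ^d satisfy, for every coordinate i ∈ {1,...,d}, |{x ∈ P : x_i < t_i}| = |{x ∈ P : x_i > t_i}|, and let m = (1/n) Σ_{y∈P} y be the mean of P. Then max_{x∈P} ‖x − t‖_p ≤ (1 + 2^{1/p}) · max_{x∈P} ‖x − m‖_p, and max_{x∈P} ‖x − m‖_p ≤ max_{x,y∈P} ‖x − y‖_p, where ‖·‖_p denotes the ℓ_p norm on ℝ^d. -/

import Mathlib

open Finset
open scoped Classical

/-- The ℓ_p norm on ℝ^d (for a real exponent p). -/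
noncomputable def lpNorm (p : ℝ) {d : ℕ} (x : Fin d → ℝ) : ℝ :=
  (∑ i, |x i| ^ p) ^ (1 / p)

lemma lpNorm_add (p : ℝ) (hp : 1 ≤ p) {d : ℕ} (x y : Fin d → ℝ) :
    lpNorm p (x + y) ≤ lpNorm p x + lpNorm p y :=
  Real.Lp_add_le Finset.univ x y hp

lemma lpNorm_nonneg' (p : ℝ) {d : ℕ} (x : Fin d → ℝ) : 0 ≤ lpNorm p x := by
  unfold lpNorm; positivity

lemma lpNorm_rpow (p : ℝ) (hp : 1 ≤ p) {d : ℕ} (x : Fin d → ℝ) :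
    lpNorm p x ^ p = ∑ i, |x i| ^ p := by
  unfold lpNorm
  rw [← Real.rpow_mul (by positivity), one_div, inv_mul_cancel₀ (by linarith), Real.rpow_one]

lemma lpNorm_smul (p : ℝ) (hp : 1 ≤ p) {d : ℕ} (c : ℝ) (hc : 0 ≤ c) (x : Fin d → ℝ) :
    lpNorm p (c • x) = c * lpNorm p x := by
  unfold lpNorm
  have : ∀ i, |(c • x) i| ^ p = c ^ p * |x i| ^ p := fun i => by
    rw [Pi.smul_apply, smul_eq_mul, abs_mul, abs_of_nonneg hc,
      Real.mul_rpow hc (abs_nonneg _)]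
  simp only [this]
  rw [← Finset.mul_sum, Real.mul_rpow (by positivity) (by positivity), ← Real.rpow_mul hc,
    mul_one_div_cancel (by linarith), Real.rpow_one]

lemma lpNorm_zero' (p : ℝ) (hp : 1 ≤ p) {d : ℕ} : lpNorm p (0 : Fin d → ℝ) = 0 := by
  have := lpNorm_smul p hp 0 le_rfl (0 : Fin d → ℝ)
  simpa using this

lemma sum_bound {α : Type*} (P S : Finset α) (hS : S ⊆ P) (f : α → ℝ) (c : ℝ)
    (hc : 0 ≤ c) (hf : ∀ x, 0 ≤ f x) (h : ∀ x ∈ S, c ≤ f x) (hcard : P.card ≤ 2 * S.card) :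
    (P.card : ℝ) * c ≤ 2 * ∑ x ∈ P, f x := by
  have h1 : (S.card : ℝ) * c ≤ ∑ x ∈ S, f x := by
    have := Finset.card_nsmul_le_sum S f c h
    simpa using this
  have h2 : ∑ x ∈ S, f x ≤ ∑ x ∈ P, f x :=
    Finset.sum_le_sum_of_subset_of_nonneg hS fun x _ _ => hf x
  have h3 : (P.card : ℝ) ≤ 2 * S.card := by exact_mod_cast hcard
  nlinarith [mul_le_mul_of_nonneg_right h3 hc]

lemma coord_bound {α : Type*} (p : ℝ) (hp : 1 ≤ p) (P : Finset α) (g : α → ℝ) (t m : ℝ)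
    (ht : (P.filter fun x => g x < t).card = (P.filter fun x => t < g x).card) :
    (P.card : ℝ) * |t - m| ^ p ≤ 2 * ∑ x ∈ P, |g x - m| ^ p := by
  have hp0 : 0 ≤ p := by linarith
  rcases le_total m t with hmt | hmt
  · refine sum_bound P (P.filter fun x => ¬ g x < t) (Finset.filter_subset _ _) _ _
      (by positivity) (fun x => by positivity) ?_ ?_
    · intro x hx
      have hx := (Finset.mem_filter.1 hx).2
      refine Real.rpow_le_rpow (abs_nonneg _) ?_ hp0
      rw [abs_of_nonneg (by linarith), abs_of_nonneg (by linarith)]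
      linarith
    · have h1 := Finset.card_filter_add_card_filter_not (s := P) (fun x => g x < t)
      have h2 : (P.filter fun x => t < g x).card ≤ (P.filter fun x => ¬ g x < t).card :=
        Finset.card_le_card (Finset.monotone_filter_right _ fun x _ hx => not_lt.2 (le_of_lt hx))
      omega
  · refine sum_bound P (P.filter fun x => ¬ t < g x) (Finset.filter_subset _ _) _ _
      (by positivity) (fun x => by positivity) ?_ ?_
    · intro x hx
      have hx := (Finset.mem_filter.1 hx).2
      refine Real.rpow_le_rpow (abs_nonneg _) ?_ hp0
      rw [abs_of_nonpos (by linarith), abs_of_nonpos (by linarith)]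
      linarith
    · have h1 := Finset.card_filter_add_card_filter_not (s := P) (fun x => t < g x)
      have h2 : (P.filter fun x => g x < t).card ≤ (P.filter fun x => ¬ t < g x).card :=
        Finset.card_le_card (Finset.monotone_filter_right _ fun x _ hx => not_lt.2 (le_of_lt hx))
      omega

/-- If `t` is a coordinatewise median of the nonempty finite set `P ⊆ ℝ^d` and `m`
is the mean of `P`, then `max_{x∈P} ‖x-t‖_p ≤ (1 + 2^{1/p}) max_{x∈P} ‖x-m‖_p`, and
`max_{x∈P} ‖x-m‖_p ≤ max_{x,y∈P} ‖x-y‖_p`. -/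
theorem stmt3 (p : ℝ) (hp : 1 ≤ p) {d : ℕ} (P : Finset (Fin d → ℝ)) (hP : P.Nonempty)
    (t m : Fin d → ℝ)
    (ht : ∀ i : Fin d,
      (P.filter fun x => x i < t i).card = (P.filter fun x => t i < x i).card)
    (hm : m = (P.card : ℝ)⁻¹ • ∑ y ∈ P, y) :
    P.sup' hP (fun x => lpNorm p (x - t)) ≤
      (1 + (2 : ℝ) ^ (1 / p)) * P.sup' hP (fun x => lpNorm p (x - m)) ∧
    P.sup' hP (fun x => lpNorm p (x - m)) ≤
      (P ×ˢ P).sup' (hP.product hP) (fun z => lpNorm p (z.1 - z.2)) := by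
  have hn : (0 : ℝ) < P.card := by exact_mod_cast hP.card_pos
  have hp0 : 0 < p := by linarith
  constructor
  · set R := P.sup' hP (fun x => lpNorm p (x - m)) with hR
    have hxR : ∀ x ∈ P, lpNorm p (x - m) ≤ R := fun x hx =>
      Finset.le_sup' (fun x => lpNorm p (x - m)) hx
    have hR0 : 0 ≤ R := by
      obtain ⟨x, hx⟩ := hP
      exact (lpNorm_nonneg' p _).trans (hxR x hx)
    have key : lpNorm p (m - t) ^ p ≤ 2 * R ^ p := by
      rw [lpNorm_rpow p hp]
      have h1 : (P.card : ℝ) * ∑ i, |(m - t) i| ^ p ≤ 2 * ∑ x ∈ P, lpNorm p (x - m) ^ p := by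
        simp only [lpNorm_rpow p hp]
        rw [Finset.sum_comm, Finset.mul_sum, Finset.mul_sum]
        refine Finset.sum_le_sum fun i _ => ?_
        have := coord_bound p hp P (fun x => x i) (t i) (m i) (by convert ht i)
        rw [abs_sub_comm] at this
        simpa using this
      have h2 : ∑ x ∈ P, lpNorm p (x - m) ^ p ≤ P.card * R ^ p := by
        have := Finset.sum_le_card_nsmul P (fun x => lpNorm p (x - m) ^ p) (R ^ p)
          fun x hx => Real.rpow_le_rpow (lpNorm_nonneg' p _) (hxR x hx) hp0.le
        simpa using this
      refine le_of_mul_le_mul_left ?_ hn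
      linarith
    have key2 : lpNorm p (m - t) ≤ 2 ^ (1 / p) * R := by
      refine (Real.rpow_le_rpow_iff (lpNorm_nonneg' p _) (by positivity) hp0).1 ?_
      rwa [Real.mul_rpow (by positivity) hR0, ← Real.rpow_mul (by norm_num),
        one_div_mul_cancel hp0.ne', Real.rpow_one]
    refine Finset.sup'_le _ _ fun x hx => ?_
    have h := lpNorm_add p hp (x - m) (m - t)
    rw [sub_add_sub_cancel] at h
    linarith [hxR x hx]
  · refine Finset.sup'_le _ _ fun x hx => ?_
    set D := (P ×ˢ P).sup' (hP.product hP) (fun z => lpNorm p (z.1 - z.2)) with hD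
    have e : x - m = (P.card : ℝ)⁻¹ • ∑ y ∈ P, (x - y) := by
      rw [Finset.sum_sub_distrib, smul_sub, ← hm, Finset.sum_const, ← Nat.cast_smul_eq_nsmul ℝ,
        smul_smul, inv_mul_cancel₀ hn.ne', one_smul]
    have h1 : lpNorm p (∑ y ∈ P, (x - y)) ≤ ∑ y ∈ P, lpNorm p (x - y) :=
      Finset.le_sum_of_subadditive (lpNorm p) (lpNorm_zero' p hp).le (lpNorm_add p hp) P _
    have h2 : ∑ y ∈ P, lpNorm p (x - y) ≤ P.card * D := by
      have := Finset.sum_le_card_nsmul P (fun y => lpNorm p (x - y)) D fun y hy =>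
        Finset.le_sup' (fun z : (Fin d → ℝ) × (Fin d → ℝ) => lpNorm p (z.1 - z.2))
          (Finset.mk_mem_product hx hy)
      simpa using this
    rw [e, lpNorm_smul p hp _ (by positivity), inv_mul_le_iff₀ hn]
    exact h1.trans h2
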